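/- For every n ∈ ℕ there exists a (2·3ⁿ − 2)-critical permutation of length at least 15ⁿ. In particular, for every n there exists a permutation of length at least 15ⁿ that is not (2·3ⁿ − 2)-coverable although every proper pattern of it is (2·3ⁿ − 2)-coverable. -/

import Mathlib

/-- The subsequence of `π` indexed by `S` is increasing. -/
def IsIncOn {n : ℕ} (π : Equiv.Perm (Fin n)) (S : Set (Fin n)) : Prop :=
  ∀ i ∈ S, ∀ j ∈ S, i < j → π i < π j

/-- The subsequence of `π` indexed by `S` is decreasing. -/
def IsDecOn {n : ℕ} (π : Equiv.Perm (Fin n)) (S : Set (Fin n)) : Prop :=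
  ∀ i ∈ S, ∀ j ∈ S, i < j → π j < π i

/-- `π` is `(r,s)`-coverable: its index set can be partitioned into `r` sets
indexing increasing subsequences and `s` sets indexing decreasing subsequences. -/
def Coverable {n : ℕ} (π : Equiv.Perm (Fin n)) (r s : ℕ) : Prop :=
  ∃ c : Fin n → Fin r ⊕ Fin s,
    (∀ a : Fin r, IsIncOn π {i | c i = Sum.inl a}) ∧
    (∀ b : Fin s, IsDecOn π {i | c i = Sum.inr b})

/-- `π` is `k`-coverable: `(r,s)`-coverable for some `r + s = k`. -/
def KCoverable {n : ℕ} (π : Equiv.Perm (Fin n)) (k : ℕ) : Prop :=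
  ∃ r s, r + s = k ∧ Coverable π r s

/-- `τ` is a pattern of `π`. -/
def Pattern {m n : ℕ} (τ : Equiv.Perm (Fin m)) (π : Equiv.Perm (Fin n)) : Prop :=
  ∃ f : Fin m → Fin n, StrictMono f ∧ ∀ i j, τ i < τ j ↔ π (f i) < π (f j)

/-- `τ` is a proper pattern of `π`. -/
def ProperPattern {m n : ℕ} (τ : Equiv.Perm (Fin m)) (π : Equiv.Perm (Fin n)) : Prop :=
  m < n ∧ Pattern τ π

/-- `π` is `(r,s)`-critical. -/
def RSCritical {n : ℕ} (π : Equiv.Perm (Fin n)) (r s : ℕ) : Prop :=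
  ¬ Coverable π r s ∧
    ∀ (m : ℕ) (τ : Equiv.Perm (Fin m)), ProperPattern τ π → Coverable τ r s

/-- `π` is `k`-critical. -/
def KCritical {n : ℕ} (π : Equiv.Perm (Fin n)) (k : ℕ) : Prop :=
  ¬ KCoverable π k ∧
    ∀ (m : ℕ) (τ : Equiv.Perm (Fin m)), ProperPattern τ π → KCoverable τ k

/-- `π` is `(r,s)`-sharp: `(r,s)`-critical and `(0,s+1)`-coverable. -/
def RSSharp {n : ℕ} (π : Equiv.Perm (Fin n)) (r s : ℕ) : Prop :=
  RSCritical π r s ∧ Coverable π 0 (s + 1)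

/-- `D(π)`: the set of pairs `(r,s)` such that `π` is not `(r,s)`-coverable. -/
def DSet {n : ℕ} (π : Equiv.Perm (Fin n)) : Set (ℕ × ℕ) :=
  {p | ¬ Coverable π p.1 p.2}

/-- A downset: a finite, downward-closed subset of `ℕ²`. -/
def IsDownset (A : Set (ℕ × ℕ)) : Prop :=
  A.Finite ∧ ∀ p ∈ A, ∀ q : ℕ × ℕ, q.1 ≤ p.1 → q.2 ≤ p.2 → q ∈ A

/-- `A ⊕ B` for subsets of `ℕ²`. -/
def setOplus (A B : Set (ℕ × ℕ)) : Set (ℕ × ℕ) :=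
  {p | ∀ s₁ s₂ : ℕ, s₁ + s₂ = p.2 → (p.1, s₁) ∈ A ∨ (p.1, s₂) ∈ B}

/-- `A ⊖ B` for subsets of `ℕ²`. -/
def setOminus (A B : Set (ℕ × ℕ)) : Set (ℕ × ℕ) :=
  {p | ∀ r₁ r₂ : ℕ, r₁ + r₂ = p.1 → (r₁, p.2) ∈ A ∨ (r₂, p.2) ∈ B}

/-- `π` is `A`-coverable. -/
def ACoverable {n : ℕ} (π : Equiv.Perm (Fin n)) (A : Set (ℕ × ℕ)) : Prop :=
  ∃ p ∈ A, Coverable π p.1 p.2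

/-- `π` is `A`-critical. -/
def ACritical {n : ℕ} (π : Equiv.Perm (Fin n)) (A : Set (ℕ × ℕ)) : Prop :=
  ¬ ACoverable π A ∧
    ∀ (m : ℕ) (τ : Equiv.Perm (Fin m)), ProperPattern τ π → ACoverable τ A

/-- `π` is `A`-minimal: `A`-critical with `D(π) = A`. -/
def AMinimal {n : ℕ} (π : Equiv.Perm (Fin n)) (A : Set (ℕ × ℕ)) : Prop :=
  ACritical π A ∧ DSet π = A

/-- The triangle `T(k) = {(r,s) : r + s ≤ k}`. -/
def T (k : ℕ) : Set (ℕ × ℕ) := {p | p.1 + p.2 ≤ k}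

/-- Direct sum of permutations: `π` followed by `σ` shifted up by `n`. -/
def directSum {n m : ℕ} (π : Equiv.Perm (Fin n)) (σ : Equiv.Perm (Fin m)) :
    Equiv.Perm (Fin (n + m)) :=
  finSumFinEquiv.symm.trans ((Equiv.sumCongr π σ).trans finSumFinEquiv)

/-- Skew sum of permutations: `π` shifted up by `m`, followed by `σ`. -/
def skewSum {n m : ℕ} (π : Equiv.Perm (Fin n)) (σ : Equiv.Perm (Fin m)) :
    Equiv.Perm (Fin (n + m)) :=
  finSumFinEquiv.symm.trans (((Equiv.sumCongr π σ).trans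
    (Equiv.sumComm (Fin n) (Fin m))).trans
    (finSumFinEquiv.trans (finCongr (Nat.add_comm m n))))

/-- Tensor product of permutations: `n` copies of `σ`, ordered like `π`. -/
def tensorProd {n m : ℕ} (π : Equiv.Perm (Fin n)) (σ : Equiv.Perm (Fin m)) :
    Equiv.Perm (Fin (n * m)) :=
  finProdFinEquiv.symm.trans ((Equiv.prodCongr π σ).trans finProdFinEquiv)

/-- The restriction of `π` to the indices in `A` is `(r,s)`-coverable: indices satisfying `P` go to
the increasing classes, the others to the decreasing ones, and `c` is the number of the class. -/
def CoverableOn {n : ℕ} (π : Equiv.Perm (Fin n)) (A : Set (Fin n)) (r s : ℕ) : Prop :=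
  ∃ (P : Fin n → Prop) (c : Fin n → ℕ),
    (∀ i ∈ A, P i → c i < r) ∧ (∀ i ∈ A, ¬ P i → c i < s) ∧
    ∀ i ∈ A, ∀ j ∈ A, i < j → c i = c j →
      (P i → P j → π i < π j) ∧ (¬ P i → ¬ P j → π j < π i)

/-- `π` is not `(r,s)`-coverable but each of its one-point deletions is, and `π` is a union of
`s + 1` decreasing subsequences. -/
structure DeletionSharp {n : ℕ} (π : Equiv.Perm (Fin n)) (r s : ℕ) : Prop where
  not_coverable : ¬ CoverableOn π Set.univ r s
  deletion : ∀ i, CoverableOn π {i}ᶜ r s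
  coverable : CoverableOn π Set.univ 0 (s + 1)

theorem coverable_iff_coverableOn_univ {n : ℕ} {π : Equiv.Perm (Fin n)} {r s : ℕ} :
    Coverable π r s ↔ CoverableOn π Set.univ r s := by
  constructor
  · rintro ⟨c, hinc, hdec⟩
    refine ⟨fun i => (c i).isLeft = true, fun i => Sum.elim Fin.val Fin.val (c i), ?_, ?_, ?_⟩
    · intro i _ hi
      rcases h : c i with a | b <;> simp_all
    · intro i _ hi
      rcases h : c i with a | b <;> simp_all
    · intro i _ j _ hij hc
      rcases h : c i with a | b <;> rcases h' : c j with a' | b' <;>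
        simp only [h, h', Sum.elim_inl, Sum.elim_inr] at hc <;> simp [h, h']
      · obtain rfl := Fin.ext hc
        exact hinc a i h j h' hij
      · obtain rfl := Fin.ext hc
        exact hdec b i h j h' hij
  · classical
    rintro ⟨P, c, hr, hs, h⟩
    refine ⟨fun i => if hi : P i then Sum.inl ⟨c i, hr i trivial hi⟩
      else Sum.inr ⟨c i, hs i trivial hi⟩, ?_, ?_⟩
    · intro a i hi j hj hij
      by_cases hPi : P i <;> by_cases hPj : P j <;> simp [hPi, hPj, Fin.ext_iff] at hi hj
      exact (h i trivial j trivial hij (hi.trans hj.symm)).1 hPi hPj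
    · intro a i hi j hj hij
      by_cases hPi : P i <;> by_cases hPj : P j <;> simp [hPi, hPj, Fin.ext_iff] at hi hj
      exact (h i trivial j trivial hij (hi.trans hj.symm)).2 hPi hPj

namespace CoverableOn

variable {n : ℕ} {π : Equiv.Perm (Fin n)} {A : Set (Fin n)} {r s : ℕ}

theorem subset {B : Set (Fin n)} (h : CoverableOn π A r s) (hB : B ⊆ A) : CoverableOn π B r s := by
  obtain ⟨P, c, h₁, h₂, h₃⟩ := h
  exact ⟨P, c, fun i hi => h₁ i (hB hi), fun i hi => h₂ i (hB hi),
    fun i hi j hj => h₃ i (hB hi) j (hB hj)⟩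

theorem of_pattern {m : ℕ} {τ : Equiv.Perm (Fin m)} {f : Fin m → Fin n} (h : CoverableOn π A r s)
    (hf : StrictMono f) (hτ : ∀ i j, τ i < τ j ↔ π (f i) < π (f j)) (hA : ∀ i, f i ∈ A) :
    CoverableOn τ Set.univ r s := by
  obtain ⟨P, c, h₁, h₂, h₃⟩ := h
  refine ⟨P ∘ f, c ∘ f, fun i _ => h₁ _ (hA i), fun i _ => h₂ _ (hA i), fun i _ j _ hij hc => ?_⟩
  have := h₃ _ (hA i) _ (hA j) (hf hij) hc
  simpa [hτ] using this

/-- A deleted point can be put back at the cost of one more increasing subsequence. -/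
theorem insert_point {i : Fin n} (h : CoverableOn π {i}ᶜ r s) :
    CoverableOn π Set.univ (r + 1) s := by
  classical
  obtain ⟨P, c, h₁, h₂, h₃⟩ := h
  refine ⟨fun j => j = i ∨ P j, fun j => if j = i then r else c j, ?_, ?_, ?_⟩
  · intro j _ hj
    by_cases hji : j = i
    · simp [hji]
    · have := h₁ j hji (by tauto)
      simp only [hji, if_false]
      lia
  · intro j _ hj
    push Not at hj
    simpa [hj.1] using h₂ j hj.1 hj.2
  · intro j _ k _ hjk hc
    by_cases hj : j = i <;> by_cases hk : k = i
    · subst hj hk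
      exact absurd hjk (lt_irrefl _)
    · simp only [hj, hk, if_true, if_false, true_or, true_implies, false_or, not_true,
        false_implies, and_true] at hc ⊢
      intro hP
      have := h₁ k hk hP
      lia
    · simp only [hj, hk, if_true, if_false, true_or, true_implies, false_or, not_true,
        false_implies, implies_true, and_true] at hc ⊢
      intro hP
      have := h₁ j hj hP
      lia
    · simp only [hj, hk, if_false, false_or] at hc ⊢
      exact h₃ j hj k hk hjk hc

end CoverableOn

/-- A weighted form of Mirsky's theorem: if every chain has weight at most `W`, the elements can be
assigned intervals `[h i, h i + w i)` inside `[0, W)` that are ordered like the elements. -/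
theorem exists_weighted_height {n : ℕ} (lt : Fin n → Fin n → Prop)
    (hlt : ∀ i j, lt i j → i < j) (htrans : ∀ i j k, lt i j → lt j k → lt i k)
    (w : Fin n → ℕ) (W : ℕ)
    (hW : ∀ C : Finset (Fin n), (∀ i ∈ C, ∀ j ∈ C, i < j → lt i j) → ∑ i ∈ C, w i ≤ W) :
    ∃ h : Fin n → ℕ, (∀ i, h i + w i ≤ W) ∧ ∀ i j, lt i j → h i + w i ≤ h j := by
  classical
  let chains (i : Fin n) : Finset (Finset (Fin n)) := Finset.univ.filter fun C =>
    (∀ x ∈ C, lt x i) ∧ ∀ x ∈ C, ∀ y ∈ C, x < y → lt x y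
  have attained (i : Fin n) :
      ∃ C, (∀ x ∈ C, lt x i) ∧ (∀ x ∈ insert i C, ∀ y ∈ insert i C, x < y → lt x y) ∧
        (chains i).sup (fun C => ∑ x ∈ C, w x) + w i = ∑ x ∈ insert i C, w x := by
    obtain ⟨C, hC, hsup⟩ := Finset.exists_mem_eq_sup (chains i) ⟨∅, by simp [chains]⟩
      (fun C => ∑ x ∈ C, w x)
    simp only [chains, Finset.mem_filter, Finset.mem_univ, true_and] at hC
    refine ⟨C, hC.1, ?_, ?_⟩
    · intro x hx y hy hxy
      rcases Finset.mem_insert.1 hx with rfl | hx' <;> rcases Finset.mem_insert.1 hy with rfl | hy'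
      · exact absurd hxy (lt_irrefl _)
      · exact absurd (hlt _ _ (hC.1 y hy')) hxy.asymm
      · exact hC.1 x hx'
      · exact hC.2 x hx' y hy' hxy
    · rw [hsup, Finset.sum_insert, add_comm]
      exact fun hi => lt_irrefl _ (hlt _ _ (hC.1 i hi))
  refine ⟨fun i => (chains i).sup fun C => ∑ x ∈ C, w x, fun i => ?_, fun i j hij => ?_⟩
  · obtain ⟨C, -, hC, hsum⟩ := attained i
    exact hsum.trans_le (hW _ hC)
  · obtain ⟨C, hlow, hC, hsum⟩ := attained i
    refine hsum.trans_le (Finset.le_sup (f := fun C => ∑ x ∈ C, w x) ?_)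
    simp only [chains, Finset.mem_filter, Finset.mem_univ, true_and]
    refine ⟨fun x hx => ?_, hC⟩
    rcases Finset.mem_insert.1 hx with rfl | hx
    · exact hij
    · exact htrans _ _ _ (hlow x hx) hij

theorem exists_increasing_height {n : ℕ} (π : Equiv.Perm (Fin n)) (w : Fin n → ℕ) (W : ℕ)
    (hW : ∀ C : Finset (Fin n), IsIncOn π C → ∑ i ∈ C, w i ≤ W) :
    ∃ h : Fin n → ℕ, (∀ i, h i + w i ≤ W) ∧
      ∀ i j, i < j → π i < π j → h i + w i ≤ h j := by
  obtain ⟨h, h₁, h₂⟩ := exists_weighted_height (fun i j => i < j ∧ π i < π j) (fun _ _ => And.left)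
    (fun _ _ _ hij hjk => ⟨hij.1.trans hjk.1, hij.2.trans hjk.2⟩) w W
    (fun C hC => hW C fun i hi j hj hij => (hC i hi j hj hij).2)
  exact ⟨h, h₁, fun i j hij hπ => h₂ i j ⟨hij, hπ⟩⟩

theorem exists_decreasing_height {n : ℕ} (π : Equiv.Perm (Fin n)) (w : Fin n → ℕ) (W : ℕ)
    (hW : ∀ C : Finset (Fin n), IsDecOn π C → ∑ i ∈ C, w i ≤ W) :
    ∃ h : Fin n → ℕ, (∀ i, h i + w i ≤ W) ∧
      ∀ i j, i < j → π j < π i → h i + w i ≤ h j := by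
  obtain ⟨h, h₁, h₂⟩ := exists_weighted_height (fun i j => i < j ∧ π j < π i) (fun _ _ => And.left)
    (fun _ _ _ hij hjk => ⟨hij.1.trans hjk.1, hjk.2.trans hij.2⟩) w W
    (fun C hC => hW C fun i hi j hj hij => (hC i hi j hj hij).2)
  exact ⟨h, h₁, fun i j hij hπ => h₂ i j ⟨hij, hπ⟩⟩

/-! ### Tensor products -/

theorem finProdFinEquiv_lt_iff {n m : ℕ} (a a' : Fin n) (b b' : Fin m) :
    finProdFinEquiv (a, b) < finProdFinEquiv (a', b') ↔ a < a' ∨ a = a' ∧ b < b' := by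
  have key (x x' : Fin n) (y y' : Fin m) (h : x < x') :
      finProdFinEquiv (x, y) < finProdFinEquiv (x', y') := by
    simp only [Fin.lt_def, finProdFinEquiv_apply_val] at h ⊢
    have := Nat.mul_le_mul_left m (Nat.succ_le_of_lt h)
    rw [Nat.mul_succ] at this
    have := y.isLt
    lia
  rcases lt_trichotomy a a' with h | rfl | h
  · simp [h, key]
  · rw [Fin.lt_def]
    simp
  · simp [h.not_gt, h.ne', (key _ _ b' b h).le]

theorem tensorProd_apply {n m : ℕ} (π : Equiv.Perm (Fin n)) (σ : Equiv.Perm (Fin m))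
    (a : Fin n) (b : Fin m) :
    tensorProd π σ (finProdFinEquiv (a, b)) = finProdFinEquiv (π a, σ b) := by
  simp [tensorProd]

theorem coverableOn_tensorProd {n m : ℕ} {π : Equiv.Perm (Fin n)} {σ : Equiv.Perm (Fin m)}
    {A : Fin n → Set (Fin m)} {r s : Fin n → ℕ} {R S : ℕ}
    (hσ : ∀ a, CoverableOn σ (A a) (r a) (s a))
    (hR : ∀ C : Finset (Fin n), IsDecOn π C → ∑ i ∈ C, r i ≤ R)
    (hS : ∀ C : Finset (Fin n), IsIncOn π C → ∑ i ∈ C, s i ≤ S) :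
    CoverableOn (tensorProd π σ)
      {x | (finProdFinEquiv.symm x).2 ∈ A (finProdFinEquiv.symm x).1} R S := by
  classical
  obtain ⟨g, hgR, hg⟩ := exists_decreasing_height π r R hR
  obtain ⟨h, hhS, hh⟩ := exists_increasing_height π s S hS
  choose P c hr hs hc using hσ
  let P' (x : Fin n × Fin m) : Prop := P x.1 x.2
  let c' (x : Fin n × Fin m) : ℕ := if P x.1 x.2 then g x.1 + c x.1 x.2 else h x.1 + c x.1 x.2
  refine ⟨fun x => P' (finProdFinEquiv.symm x), fun x => c' (finProdFinEquiv.symm x), ?_, ?_, ?_⟩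
  · intro x hx hP
    obtain ⟨⟨a, b⟩, rfl⟩ := finProdFinEquiv.surjective x
    simp only [Set.mem_ofPred_eq, Equiv.symm_apply_apply, P', c'] at hx hP ⊢
    rw [if_pos hP]
    have := hr a b hx hP
    have := hgR a
    lia
  · intro x hx hP
    obtain ⟨⟨a, b⟩, rfl⟩ := finProdFinEquiv.surjective x
    simp only [Set.mem_ofPred_eq, Equiv.symm_apply_apply, P', c'] at hx hP ⊢
    rw [if_neg hP]
    have := hs a b hx hP
    have := hhS a
    lia
  · intro x hx y hy hxy
    obtain ⟨⟨a, b⟩, rfl⟩ := finProdFinEquiv.surjective x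
    obtain ⟨⟨a', b'⟩, rfl⟩ := finProdFinEquiv.surjective y
    simp only [Set.mem_ofPred_eq, Equiv.symm_apply_apply, P', c', tensorProd_apply,
      finProdFinEquiv_lt_iff] at hx hy hxy ⊢
    intro hcol
    rcases hxy with hxy | ⟨rfl, hxy⟩
    · have hne : π a ≠ π a' := fun e => hxy.ne (π.injective e)
      constructor
      · intro hP hP'
        rw [if_pos hP, if_pos hP'] at hcol
        refine Or.inl ((lt_or_gt_of_ne hne).resolve_right fun hgt => ?_)
        have := hg a a' hxy hgt
        have := hr a b hx hP
        lia
      · intro hP hP'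
        rw [if_neg hP, if_neg hP'] at hcol
        refine Or.inl ((lt_or_gt_of_ne hne).resolve_left fun hgt => ?_)
        have := hh a a' hxy hgt
        have := hs a b hx hP
        lia
    · constructor
      · intro hP hP'
        rw [if_pos hP, if_pos hP'] at hcol
        exact Or.inr ⟨rfl, (hc a b hx b' hy hxy (by lia)).1 hP hP'⟩
      · intro hP hP'
        rw [if_neg hP, if_neg hP'] at hcol
        exact Or.inr ⟨rfl, (hc a b hx b' hy hxy (by lia)).2 hP hP'⟩

theorem exists_injOn_lt_of_card_le {s : Finset ℕ} {k : ℕ} (h : s.card ≤ k) :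
    ∃ f : ℕ → ℕ, (∀ x ∈ s, f x < k) ∧ Set.InjOn f s := by
  have hle : (s : Set ℕ).encard ≤ (Set.Iio k).encard := by
    rw [Set.encard_coe_eq_coe_finsetCard, ← Finset.coe_Iio, Set.encard_coe_eq_coe_finsetCard]
    simpa using h
  obtain ⟨f, hf, hinj⟩ := s.finite_toSet.exists_injOn_of_encard_le hle
  exact ⟨f, fun x hx => hf hx, hinj⟩

/-- Only the number of colours that are used matters. -/
theorem coverableOn_univ_of_card_image_le {n : ℕ} {π : Equiv.Perm (Fin n)} {r s : ℕ}
    (P : Fin n → Prop) [DecidablePred P] (c : Fin n → ℕ)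
    (h : ∀ i j, i < j → c i = c j → (P i → P j → π i < π j) ∧ (¬ P i → ¬ P j → π j < π i))
    (hr : ((Finset.univ.filter P).image c).card ≤ r)
    (hs : ((Finset.univ.filter fun i => ¬ P i).image c).card ≤ s) :
    CoverableOn π Set.univ r s := by
  obtain ⟨f, hf, hfinj⟩ := exists_injOn_lt_of_card_le hr
  obtain ⟨g, hg, hginj⟩ := exists_injOn_lt_of_card_le hs
  have memP {i : Fin n} (hi : P i) : c i ∈ (Finset.univ.filter P).image c :=
    Finset.mem_image_of_mem c (by simpa using hi)
  have memN {i : Fin n} (hi : ¬ P i) : c i ∈ (Finset.univ.filter fun i => ¬ P i).image c :=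
    Finset.mem_image_of_mem c (by simpa using hi)
  refine ⟨P, fun i => if P i then f (c i) else g (c i), ?_, ?_, ?_⟩
  · intro i _ hi
    simpa [hi] using hf _ (memP hi)
  · intro i _ hi
    simpa [hi] using hg _ (memN hi)
  · intro i _ j _ hij hc
    constructor
    · intro hi hj
      simp only [hi, hj, if_true] at hc
      exact (h i j hij (hfinj (memP hi) (memP hj) hc)).1 hi hj
    · intro hi hj
      simp only [hi, hj, if_false] at hc
      exact (h i j hij (hginj (memN hi) (memN hj) hc)).2 hi hj

theorem sum_ite_lt_card_le {ι : Type*} (C : Finset ι) (F : ι → Finset ℕ) {k r R : ℕ}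
    (hdisj : (C : Set ι).PairwiseDisjoint F) (hF : ∀ i ∈ C, F i ⊆ Finset.range R)
    (hR : R < (r + 1) * (k + 1)) : ∑ i ∈ C, (if k < (F i).card then 1 else 0) ≤ r := by
  classical
  have hle : ∑ i ∈ C, (F i).card ≤ R := by
    rw [← Finset.card_biUnion hdisj]
    simpa using Finset.card_le_card (Finset.biUnion_subset.2 hF)
  have hmul : (∑ i ∈ C, (if k < (F i).card then 1 else 0)) * (k + 1) ≤ ∑ i ∈ C, (F i).card := by
    rw [Finset.sum_mul]
    refine Finset.sum_le_sum fun i _ => ?_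
    split_ifs with h <;> lia
  exact Nat.lt_succ_iff.1 (Nat.lt_of_mul_lt_mul_right ((hmul.trans hle).trans_lt hR))

theorem not_coverableOn_tensorProd {n m : ℕ} {π : Equiv.Perm (Fin n)} {σ : Equiv.Perm (Fin m)}
    {r s r' s' R S : ℕ} (hπ : ¬ CoverableOn π Set.univ r s) (hσ : ¬ CoverableOn σ Set.univ r' s')
    (hR : R < (r + 1) * (r' + 1)) (hS : S < (s + 1) * (s' + 1)) :
    ¬ CoverableOn (tensorProd π σ) Set.univ R S := by
  classical
  rintro ⟨P, c, hr, hs, hc⟩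
  let F (a : Fin n) : Finset ℕ := (Finset.univ.filter fun b : Fin m =>
    P (finProdFinEquiv (a, b))).image fun b => c (finProdFinEquiv (a, b))
  let G (a : Fin n) : Finset ℕ := (Finset.univ.filter fun b : Fin m =>
    ¬ P (finProdFinEquiv (a, b))).image fun b => c (finProdFinEquiv (a, b))
  have hFG (a : Fin n) : r' < (F a).card ∨ s' < (G a).card := by
    by_contra! h
    refine hσ (coverableOn_univ_of_card_image_le _ _ (fun b b' hb hcol => ?_) h.1 h.2)
    have := hc (finProdFinEquiv (a, b)) trivial (finProdFinEquiv (a, b')) trivial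
      ((finProdFinEquiv_lt_iff ..).2 (Or.inr ⟨rfl, hb⟩)) hcol
    simpa [tensorProd_apply, finProdFinEquiv_lt_iff] using this
  have hF (a a' : Fin n) (ha : a < a') (hπa : π a' < π a) : Disjoint (F a) (F a') := by
    rw [Finset.disjoint_left]
    intro x hx hx'
    simp only [F, Finset.mem_image, Finset.mem_filter, Finset.mem_univ, true_and] at hx hx'
    obtain ⟨b, hb, rfl⟩ := hx
    obtain ⟨b', hb', hcol⟩ := hx'
    have := (hc _ trivial _ trivial ((finProdFinEquiv_lt_iff a a' b b').2 (Or.inl ha))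
      hcol.symm).1 hb hb'
    simp only [tensorProd_apply, finProdFinEquiv_lt_iff] at this
    rcases this with h | ⟨h, -⟩
    · exact h.asymm hπa
    · exact hπa.ne' h
  have hG (a a' : Fin n) (ha : a < a') (hπa : π a < π a') : Disjoint (G a) (G a') := by
    rw [Finset.disjoint_left]
    intro x hx hx'
    simp only [G, Finset.mem_image, Finset.mem_filter, Finset.mem_univ, true_and] at hx hx'
    obtain ⟨b, hb, rfl⟩ := hx
    obtain ⟨b', hb', hcol⟩ := hx'
    have := (hc _ trivial _ trivial ((finProdFinEquiv_lt_iff a a' b b').2 (Or.inl ha))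
      hcol.symm).2 hb hb'
    simp only [tensorProd_apply, finProdFinEquiv_lt_iff] at this
    rcases this with h | ⟨h, -⟩
    · exact h.asymm hπa
    · exact hπa.ne' h
  obtain ⟨g, hgr, hg⟩ := exists_decreasing_height π (fun a => if r' < (F a).card then 1 else 0) r
    fun C hC => sum_ite_lt_card_le C F (fun a ha a' ha' hne => by
      rcases lt_or_gt_of_ne hne with h | h
      · exact hF a a' h (hC a ha a' ha' h)
      · exact (hF a' a h (hC a' ha' a ha h)).symm) (fun a _ x hx => by
      simp only [F, Finset.mem_image, Finset.mem_filter, Finset.mem_univ, true_and] at hx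
      obtain ⟨b, hb, rfl⟩ := hx
      exact Finset.mem_range.2 (hr _ trivial hb)) hR
  obtain ⟨h, hhs, hh⟩ := exists_increasing_height π (fun a => if s' < (G a).card then 1 else 0) s
    fun C hC => sum_ite_lt_card_le C G (fun a ha a' ha' hne => by
      rcases lt_or_gt_of_ne hne with h | h
      · exact hG a a' h (hC a ha a' ha' h)
      · exact (hG a' a h (hC a' ha' a ha h)).symm) (fun a _ x hx => by
      simp only [G, Finset.mem_image, Finset.mem_filter, Finset.mem_univ, true_and] at hx
      obtain ⟨b, hb, rfl⟩ := hx
      exact Finset.mem_range.2 (hs _ trivial hb)) hS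
  refine hπ ⟨fun a => r' < (F a).card, fun a => if r' < (F a).card then g a else h a, ?_, ?_, ?_⟩
  · intro a _ ha
    have := hgr a
    simp only [ha, if_true] at this ⊢
    lia
  · intro a _ ha
    have := hhs a
    simp only [(hFG a).resolve_left ha, ha, if_true, if_false] at this ⊢
    lia
  · intro a _ a' _ haa' hcol
    have hne : π a ≠ π a' := fun e => haa'.ne (π.injective e)
    constructor
    · intro ha ha'
      simp only [ha, ha', if_true] at hcol
      refine (lt_or_gt_of_ne hne).resolve_right fun hgt => ?_
      have := hg a a' haa' hgt
      simp only [ha, if_true] at this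
      lia
    · intro ha ha'
      simp only [ha, ha', if_false] at hcol
      refine (lt_or_gt_of_ne hne).resolve_left fun hlt => ?_
      have := hh a a' haa' hlt
      simp only [(hFG a).resolve_left ha, if_true] at this
      lia

theorem card_le_of_ne {n r : ℕ} (c : Fin n → ℕ) (C : Finset (Fin n)) (hr : ∀ i ∈ C, c i < r)
    (hc : ∀ i ∈ C, ∀ j ∈ C, i < j → c i ≠ c j) : C.card ≤ r := by
  rw [← Finset.card_range r]
  refine Finset.card_le_card_of_injOn c (fun i hi => by simpa using hr i hi) fun i hi j hj hij => ?_
  by_contra hne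
  rcases lt_or_gt_of_ne hne with h | h
  · exact hc i hi j hj h hij
  · exact hc j hj i hi h hij.symm

theorem card_le_of_isIncOn {n s : ℕ} {π : Equiv.Perm (Fin n)} (hπ : CoverableOn π Set.univ 0 s)
    {C : Finset (Fin n)} (hC : IsIncOn π C) : C.card ≤ s := by
  obtain ⟨P, c, hr, hs, hc⟩ := hπ
  have hP (i : Fin n) : ¬ P i := fun hi => Nat.not_lt_zero _ (hr i trivial hi)
  refine card_le_of_ne c C (fun i _ => hs i trivial (hP i)) fun i hi j hj hij hcol => ?_
  exact (hC i hi j hj hij).asymm ((hc i trivial j trivial hij hcol).2 (hP i) (hP j))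

theorem coverableOn_tensorProd_of_coverableOn {n m : ℕ} {π : Equiv.Perm (Fin n)}
    {σ : Equiv.Perm (Fin m)} {s s' : ℕ} (hπ : CoverableOn π Set.univ 0 s)
    (hσ : CoverableOn σ Set.univ 0 s') : CoverableOn (tensorProd π σ) Set.univ 0 (s * s') := by
  have := coverableOn_tensorProd (π := π) (A := fun _ => Set.univ) (r := fun _ => 0)
    (s := fun _ => s') (R := 0) (S := s * s') (fun _ => hσ) (fun C _ => by simp) fun C hC => by
      simpa using Nat.mul_le_mul_right s' (card_le_of_isIncOn hπ hC)
  simpa using this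

/-- Delete a point from the `i`-th copy of `σ`. In a cover of `π` minus `i`, the copies in the
increasing classes and the `i`-th one leave one decreasing class to the others. -/
theorem DeletionSharp.tensorProd {n m : ℕ} {π : Equiv.Perm (Fin n)} {σ : Equiv.Perm (Fin m)}
    {r s r' s' R S : ℕ} (hπ : DeletionSharp π r s) (hσ : DeletionSharp σ r' s')
    (hR : R + 1 = (r + 1) * (r' + 1)) (hS : S + 1 = (s + 1) * (s' + 1)) :
    DeletionSharp (tensorProd π σ) R S where
  not_coverable := not_coverableOn_tensorProd hπ.not_coverable hσ.not_coverable
    (by lia) (by lia)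
  coverable := by
    rw [hS]
    exact coverableOn_tensorProd_of_coverableOn hπ.coverable hσ.coverable
  deletion x := by
    classical
    obtain ⟨⟨i, b⟩, rfl⟩ := finProdFinEquiv.surjective x
    obtain ⟨P, c, hr, hs, hc⟩ := hπ.deletion i
    have hcov := coverableOn_tensorProd (π := π) (σ := σ)
      (A := fun j => if j = i then {b}ᶜ else Set.univ)
      (r := fun j => if j = i then r' else if P j then r' + 1 else 0)
      (s := fun j => if j = i ∨ P j then s' else s' + 1) (R := R) (S := S)
      (fun j => ?_) (fun C hC => ?_) (fun C hC => ?_)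
    · refine hcov.subset fun y hy => ?_
      obtain ⟨⟨j, b'⟩, rfl⟩ := finProdFinEquiv.surjective y
      rw [Set.mem_ofPred_eq, Equiv.symm_apply_apply]
      by_cases hj : j = i
      · subst hj
        simpa using hy
      · simp [hj]
    · by_cases hj : j = i
      · simpa [hj] using hσ.deletion b
      · by_cases hP : P j
        · simpa [hj, hP] using (hσ.deletion b).insert_point
        · simpa [hj, hP] using hσ.coverable
    · have hcard : (C.filter fun j => j ≠ i ∧ P j).card ≤ r := by
        refine card_le_of_ne c _ (fun j hj => ?_) fun j hj k hk hjk hcol => ?_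
        · simp only [Finset.mem_filter] at hj
          exact hr j hj.2.1 hj.2.2
        · simp only [Finset.mem_filter] at hj hk
          exact (hC j hj.1 k hk.1 hjk).asymm ((hc j hj.2.1 k hk.2.1 hjk hcol).1 hj.2.2 hk.2.2)
      calc _ ≤ ∑ j ∈ C, ((if j = i then r' else 0) + if j ≠ i ∧ P j then r' + 1 else 0) := by
            refine Finset.sum_le_sum fun j _ => ?_
            by_cases hj : j = i <;> by_cases hP : P j <;> simp [hj, hP]
        _ ≤ r' + r * (r' + 1) := by
            rw [Finset.sum_add_distrib, ← Finset.sum_filter _ (fun _ => r' + 1), Finset.sum_const,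
              smul_eq_mul, Finset.sum_ite_eq']
            refine add_le_add ?_ (Nat.mul_le_mul_right _ hcard)
            split_ifs <;> simp
        _ ≤ R := by lia
    · have hcard : (C.filter fun j => ¬ (j = i ∨ P j)).card ≤ s := by
        refine card_le_of_ne c _ (fun j hj => ?_) fun j hj k hk hjk hcol => ?_
        · simp only [Finset.mem_filter, not_or] at hj
          exact hs j hj.2.1 hj.2.2
        · simp only [Finset.mem_filter, not_or] at hj hk
          exact (hC j hj.1 k hk.1 hjk).asymm ((hc j hj.2.1 k hk.2.1 hjk hcol).2 hj.2.2 hk.2.2)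
      calc _ = ∑ j ∈ C, (s' + if ¬ (j = i ∨ P j) then 1 else 0) := by
            refine Finset.sum_congr rfl fun j _ => ?_
            by_cases h : j = i ∨ P j <;> simp [h]
        _ = C.card * s' + (C.filter fun j => ¬ (j = i ∨ P j)).card := by
            rw [Finset.sum_add_distrib, Finset.sum_const, smul_eq_mul, Finset.card_filter]
        _ ≤ (s + 1) * s' + s :=
            add_le_add (Nat.mul_le_mul_right _ (card_le_of_isIncOn hπ.coverable hC)) hcard
        _ ≤ S := by lia

/-! ### From `(r,s)`-criticality to `(r + s)`-criticality -/

theorem castAdd_lt_natAdd {n m : ℕ} (i : Fin n) (j : Fin m) : Fin.castAdd m i < Fin.natAdd n j := by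
  simpa [Fin.lt_def] using Nat.lt_add_right _ i.isLt

theorem directSum_castAdd {n m : ℕ} (π : Equiv.Perm (Fin n)) (σ : Equiv.Perm (Fin m)) (i : Fin n) :
    directSum π σ (Fin.castAdd m i) = Fin.castAdd m (π i) := by
  simp [directSum]

theorem directSum_natAdd {n m : ℕ} (π : Equiv.Perm (Fin n)) (σ : Equiv.Perm (Fin m)) (i : Fin m) :
    directSum π σ (Fin.natAdd n i) = Fin.natAdd n (σ i) := by
  simp [directSum]

theorem skewSum_castAdd_val {n m : ℕ} (π : Equiv.Perm (Fin n)) (σ : Equiv.Perm (Fin m))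
    (i : Fin n) : (skewSum π σ (Fin.castAdd m i) : ℕ) = m + π i := by
  simp [skewSum, add_comm]

theorem skewSum_natAdd_val {n m : ℕ} (π : Equiv.Perm (Fin n)) (σ : Equiv.Perm (Fin m))
    (i : Fin m) : (skewSum π σ (Fin.natAdd n i) : ℕ) = σ i := by
  simp [skewSum]

theorem Pattern.trans {a b c : ℕ} {ρ : Equiv.Perm (Fin a)} {σ : Equiv.Perm (Fin b)}
    {τ : Equiv.Perm (Fin c)} (h : Pattern ρ σ) (h' : Pattern σ τ) : Pattern ρ τ := by
  obtain ⟨f, hf, hρ⟩ := h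
  obtain ⟨g, hg, hσ⟩ := h'
  exact ⟨g ∘ f, hg.comp hf, fun i j => (hρ i j).trans (hσ _ _)⟩

theorem pattern_directSum_right {n m : ℕ} (π : Equiv.Perm (Fin n)) (σ : Equiv.Perm (Fin m)) :
    Pattern σ (directSum π σ) :=
  ⟨Fin.natAdd n, Fin.strictMono_natAdd n, fun i j => by simp [directSum_natAdd]⟩

theorem pattern_directSum_left {n m : ℕ} (π : Equiv.Perm (Fin n)) (σ : Equiv.Perm (Fin m)) :
    Pattern π (directSum π σ) :=
  ⟨Fin.castAdd m, Fin.strictMono_castAdd m, fun i j => by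
    rw [directSum_castAdd, directSum_castAdd, (Fin.strictMono_castAdd m).lt_iff_lt]⟩

theorem pattern_skewSum_right {n m : ℕ} (π : Equiv.Perm (Fin n)) (σ : Equiv.Perm (Fin m)) :
    Pattern σ (skewSum π σ) :=
  ⟨Fin.natAdd n, Fin.strictMono_natAdd n, fun i j => by
    rw [Fin.lt_def, Fin.lt_def, skewSum_natAdd_val, skewSum_natAdd_val]⟩

theorem pattern_skewSum_left {n m : ℕ} (π : Equiv.Perm (Fin n)) (σ : Equiv.Perm (Fin m)) :
    Pattern π (skewSum π σ) :=
  ⟨Fin.castAdd m, Fin.strictMono_castAdd m, fun i j => by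
    rw [Fin.lt_def, Fin.lt_def, skewSum_castAdd_val, skewSum_castAdd_val, Nat.add_lt_add_iff_left]⟩

theorem Pattern.coverableOn {m n r s : ℕ} {τ : Equiv.Perm (Fin m)} {π : Equiv.Perm (Fin n)}
    (h : Pattern τ π) (hπ : CoverableOn π Set.univ r s) : CoverableOn τ Set.univ r s := by
  obtain ⟨f, hf, hτ⟩ := h
  exact hπ.of_pattern hf hτ fun _ => trivial

theorem CoverableOn.directSum {n m r s : ℕ} {π : Equiv.Perm (Fin n)} {σ : Equiv.Perm (Fin m)}
    {A : Set (Fin n)} (hπ : CoverableOn π A r s) (hσ : CoverableOn σ Set.univ r 0) :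
    CoverableOn (directSum π σ) {x | ∀ i, x = Fin.castAdd m i → i ∈ A} r s := by
  obtain ⟨P, c, h₁, h₂, h₃⟩ := hπ
  obtain ⟨P', c', h₁', h₂', h₃'⟩ := hσ
  have hP' (j : Fin m) : P' j := by
    by_contra hj
    exact Nat.not_lt_zero _ (h₂' j trivial hj)
  refine ⟨Fin.addCases P P', Fin.addCases c c', ?_, ?_, ?_⟩
  · intro x hx
    induction x using Fin.addCases with
    | left i => simpa using h₁ i (hx i rfl)
    | right j => simpa using h₁' j trivial
  · intro x hx
    induction x using Fin.addCases with
    | left i => simpa using h₂ i (hx i rfl)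
    | right j => simp [hP']
  · intro x hx y hy hxy
    induction x using Fin.addCases with
    | left i =>
      induction y using Fin.addCases with
      | left j =>
        simpa [directSum_castAdd, (Fin.strictMono_castAdd m).lt_iff_lt] using
          h₃ i (hx i rfl) j (hy j rfl) ((Fin.strictMono_castAdd m).lt_iff_lt.1 hxy)
      | right j => simp [directSum_castAdd, directSum_natAdd, hP', castAdd_lt_natAdd]
    | right i =>
      induction y using Fin.addCases with
      | left j => exact absurd hxy (castAdd_lt_natAdd _ _).asymm
      | right j => simpa [directSum_natAdd] using h₃' i trivial j trivial (by simpa using hxy)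

theorem CoverableOn.skewSum {n m r s : ℕ} {π : Equiv.Perm (Fin n)} {σ : Equiv.Perm (Fin m)}
    {A : Set (Fin n)} (hπ : CoverableOn π A r s) (hσ : CoverableOn σ Set.univ 0 s) :
    CoverableOn (skewSum π σ) {x | ∀ i, x = Fin.castAdd m i → i ∈ A} r s := by
  obtain ⟨P, c, h₁, h₂, h₃⟩ := hπ
  obtain ⟨P', c', h₁', h₂', h₃'⟩ := hσ
  have hP' (j : Fin m) : ¬ P' j := fun hj => Nat.not_lt_zero _ (h₁' j trivial hj)
  refine ⟨Fin.addCases P P', Fin.addCases c c', ?_, ?_, ?_⟩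
  · intro x hx
    induction x using Fin.addCases with
    | left i => simpa using h₁ i (hx i rfl)
    | right j => simp [hP']
  · intro x hx
    induction x using Fin.addCases with
    | left i => simpa using h₂ i (hx i rfl)
    | right j => simpa using h₂' j trivial
  · intro x hx y hy hxy
    rw [Fin.lt_def, Fin.lt_def]
    induction x using Fin.addCases with
    | left i =>
      induction y using Fin.addCases with
      | left j =>
        simpa [skewSum_castAdd_val] using
          h₃ i (hx i rfl) j (hy j rfl) ((Fin.strictMono_castAdd m).lt_iff_lt.1 hxy)
      | right j =>
        have := (σ j).isLt
        simp only [skewSum_castAdd_val, skewSum_natAdd_val, Fin.addCases_left, Fin.addCases_right,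
          hP', false_implies, implies_true, true_and, not_false_eq_true, true_implies]
        lia
    | right i =>
      induction y using Fin.addCases with
      | left j => exact absurd hxy (castAdd_lt_natAdd _ _).asymm
      | right j => simpa [skewSum_natAdd_val] using h₃' i trivial j trivial (by simpa using hxy)

theorem not_coverableOn_revPerm (r : ℕ) :
    ¬ CoverableOn (Fin.revPerm : Equiv.Perm (Fin (r + 1))) Set.univ r 0 := by
  rintro ⟨P, c, h₁, h₂, h₃⟩
  have hP (i : Fin (r + 1)) : P i := by
    by_contra hi
    exact Nat.not_lt_zero _ (h₂ i trivial hi)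
  have := card_le_of_ne c Finset.univ (fun i _ => h₁ i trivial (hP i)) fun i _ j _ hij hc => by
    have := (h₃ i trivial j trivial hij hc).1 (hP i) (hP j)
    exact hij.asymm (by simpa using this)
  simp at this

theorem not_coverableOn_one (s : ℕ) :
    ¬ CoverableOn (1 : Equiv.Perm (Fin (s + 1))) Set.univ 0 s := by
  intro h
  have := card_le_of_isIncOn h (C := Finset.univ) fun i _ j _ hij => hij
  simp at this

/-- `r` increasing blocks of length `k + 1`, arranged decreasingly. -/
def decBlocks (r k : ℕ) : Equiv.Perm (Fin (r * (k + 1))) :=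
  tensorProd (Fin.revPerm : Equiv.Perm (Fin r)) (1 : Equiv.Perm (Fin (k + 1)))

/-- `s` decreasing blocks of length `k + 1`, arranged increasingly. -/
def incBlocks (s k : ℕ) : Equiv.Perm (Fin (s * (k + 1))) :=
  tensorProd (1 : Equiv.Perm (Fin s)) (Fin.revPerm : Equiv.Perm (Fin (k + 1)))

theorem le_of_coverableOn_decBlocks {r k r' s' : ℕ} (hs : s' ≤ k)
    (h : CoverableOn (decBlocks r k) Set.univ r' s') : r ≤ r' := by
  by_contra! hlt
  obtain ⟨r, rfl⟩ := Nat.exists_eq_succ_of_ne_zero (Nat.ne_zero_of_lt hlt)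
  exact not_coverableOn_tensorProd (not_coverableOn_revPerm r) (not_coverableOn_one k)
    (by lia) (by lia) h

theorem le_of_coverableOn_incBlocks {s k r' s' : ℕ} (hr : r' ≤ k)
    (h : CoverableOn (incBlocks s k) Set.univ r' s') : s ≤ s' := by
  by_contra! hlt
  obtain ⟨s, rfl⟩ := Nat.exists_eq_succ_of_ne_zero (Nat.ne_zero_of_lt hlt)
  exact not_coverableOn_tensorProd (not_coverableOn_one s) (not_coverableOn_revPerm k)
    (by lia) (by lia) h

theorem coverableOn_decBlocks (r k : ℕ) : CoverableOn (decBlocks r k) Set.univ r 0 := by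
  have hone : CoverableOn (1 : Equiv.Perm (Fin (k + 1))) Set.univ 1 0 :=
    ⟨fun _ => True, fun _ => 0, by simp, by simp, by simp⟩
  have := coverableOn_tensorProd (π := (Fin.revPerm : Equiv.Perm (Fin r)))
    (A := fun _ => Set.univ) (r := fun _ => 1) (s := fun _ => 0) (R := r) (S := 0)
    (fun _ => hone) (fun C _ => by simpa using C.card_le_univ) (fun C _ => by simp)
  simpa [decBlocks] using this

theorem coverableOn_incBlocks (s k : ℕ) : CoverableOn (incBlocks s k) Set.univ 0 s := by
  have hrev : CoverableOn (Fin.revPerm : Equiv.Perm (Fin (k + 1))) Set.univ 0 1 :=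
    ⟨fun _ => False, fun _ => 0, by simp, by simp, by simp⟩
  have := coverableOn_tensorProd (π := (1 : Equiv.Perm (Fin s)))
    (A := fun _ => Set.univ) (r := fun _ => 0) (s := fun _ => 1) (R := 0) (S := s)
    (fun _ => hrev) (fun C _ => by simp) (fun C _ => by simpa using C.card_le_univ)
  simpa [incBlocks] using this

/-- Any permutation that is not `k`-coverable has a `k`-critical pattern. -/
theorem exists_kCritical_pattern {n k : ℕ} {π : Equiv.Perm (Fin n)} (h : ¬ KCoverable π k) :
    ∃ (m : ℕ) (τ : Equiv.Perm (Fin m)), Pattern τ π ∧ KCritical τ k := by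
  classical
  have hex : ∃ m, ∃ τ : Equiv.Perm (Fin m), Pattern τ π ∧ ¬ KCoverable τ k :=
    ⟨n, π, ⟨id, strictMono_id, fun _ _ => Iff.rfl⟩, h⟩
  obtain ⟨τ, hτ, hcov⟩ := Nat.find_spec hex
  refine ⟨_, τ, hτ, hcov, fun l ρ hρ => ?_⟩
  by_contra hcov'
  exact Nat.find_min hex hρ.1 ⟨ρ, hρ.2.trans hτ, hcov'⟩

theorem DeletionSharp.exists_kCritical {n r s : ℕ} {π : Equiv.Perm (Fin n)}
    (hπ : DeletionSharp π r s) :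
    ∃ (m : ℕ) (τ : Equiv.Perm (Fin m)), n ≤ m ∧ KCritical τ (r + s) := by
  let ρ := skewSum (directSum π (decBlocks r (r + s))) (incBlocks s (r + s))
  let f (i : Fin n) := Fin.castAdd (s * (r + s + 1)) (Fin.castAdd (r * (r + s + 1)) i)
  have hρ : ¬ KCoverable ρ (r + s) := by
    rintro ⟨r', s', hsum, hcov⟩
    rw [coverable_iff_coverableOn_univ] at hcov
    have hdir := (pattern_skewSum_left _ _).coverableOn hcov
    have hr := le_of_coverableOn_decBlocks (by lia)
      ((pattern_directSum_right _ _).coverableOn hdir)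
    have hs := le_of_coverableOn_incBlocks (by lia)
      ((pattern_skewSum_right _ _).coverableOn hcov)
    obtain rfl : r' = r := by lia
    obtain rfl : s' = s := by lia
    exact hπ.not_coverable ((pattern_directSum_left _ _).coverableOn hdir)
  have hdel (i : Fin n) : CoverableOn ρ {f i}ᶜ r s := by
    refine (((hπ.deletion i).directSum (coverableOn_decBlocks r (r + s))).skewSum
      (coverableOn_incBlocks s (r + s))).subset ?_
    rintro _ hx _ rfl _ rfl rfl
    exact hx rfl
  obtain ⟨m, τ, ⟨g, hg, hτ⟩, hcrit⟩ := exists_kCritical_pattern hρ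
  refine ⟨m, τ, ?_, hcrit⟩
  have hrange (i : Fin n) : ∃ j, g j = f i := by
    by_contra! h
    exact hcrit.1 ⟨r, s, rfl, coverable_iff_coverableOn_univ.2 ((hdel i).of_pattern hg hτ h)⟩
  choose e he using hrange
  have hinj : Function.Injective e := fun i j hij => by
    have : f i = f j := by rw [← he, ← he, hij]
    simpa [f] using this
  simpa using Fintype.card_le_of_injective e hinj

/-! ### A `(2,2)`-critical permutation of length fifteen -/

/-- Backtracking search for a cover of a word by two increasing and two decreasing subsequences;
entries of the increasing ones must be at least `x₀`, `x₁`, those of the decreasing ones less than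
`y₀`, `y₁`. -/
def twoTwoSearch : List ℕ → ℕ → ℕ → ℕ → ℕ → Bool
  | [], _, _, _, _ => true
  | v :: l, x₀, x₁, y₀, y₁ =>
    (Nat.ble x₀ v && twoTwoSearch l (v + 1) x₁ y₀ y₁) ||
    ((Nat.ble x₁ v && twoTwoSearch l x₀ (v + 1) y₀ y₁) ||
    ((Nat.blt v y₀ && twoTwoSearch l x₀ x₁ v y₁) ||
    (Nat.blt v y₁ && twoTwoSearch l x₀ x₁ y₀ v)))

theorem twoTwoSearch_eq_true {n : ℕ} {π : Equiv.Perm (Fin n)} {P : Fin n → Prop} {c : Fin n → ℕ}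
    (h₁ : ∀ i, P i → c i < 2) (h₂ : ∀ i, ¬ P i → c i < 2)
    (h₃ : ∀ i j, i < j → c i = c j →
      (P i → P j → π i < π j) ∧ (¬ P i → ¬ P j → π j < π i)) :
    ∀ (l : List (Fin n)) (x₀ x₁ y₀ y₁ : ℕ), l.Pairwise (· < ·) →
      (∀ i ∈ l, P i → c i = 0 → x₀ ≤ π i) → (∀ i ∈ l, P i → c i = 1 → x₁ ≤ π i) →
      (∀ i ∈ l, ¬ P i → c i = 0 → π i < y₀) → (∀ i ∈ l, ¬ P i → c i = 1 → π i < y₁) →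
      twoTwoSearch (l.map fun i => (π i : ℕ)) x₀ x₁ y₀ y₁ = true
  | [], _, _, _, _, _, _, _, _, _ => rfl
  | i :: l, x₀, x₁, y₀, y₁, hl, hx₀, hx₁, hy₀, hy₁ => by
    rw [List.pairwise_cons] at hl
    simp only [List.forall_mem_cons] at hx₀ hx₁ hy₀ hy₁
    have ih := twoTwoSearch_eq_true h₁ h₂ h₃ l
    simp only [List.map_cons, twoTwoSearch, Bool.or_eq_true, Bool.and_eq_true, Nat.ble_eq,
      Nat.blt_eq]
    by_cases hP : P i
    · have step (j) (hj : j ∈ l) (hPj : P j) (hc : c j = c i) : (π i : ℕ) + 1 ≤ π j :=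
        (h₃ i j (hl.1 j hj) hc.symm).1 hP hPj
      obtain hc | hc : c i = 0 ∨ c i = 1 := by
        have := h₁ i hP
        lia
      · exact Or.inl ⟨hx₀.1 hP hc, ih _ _ _ _ hl.2
          (fun j hj hPj hcj => step j hj hPj (hcj.trans hc.symm)) hx₁.2 hy₀.2 hy₁.2⟩
      · exact Or.inr (Or.inl ⟨hx₁.1 hP hc, ih _ _ _ _ hl.2 hx₀.2
          (fun j hj hPj hcj => step j hj hPj (hcj.trans hc.symm)) hy₀.2 hy₁.2⟩)
    · have step (j) (hj : j ∈ l) (hPj : ¬ P j) (hc : c j = c i) : (π j : ℕ) < π i :=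
        (h₃ i j (hl.1 j hj) hc.symm).2 hP hPj
      obtain hc | hc : c i = 0 ∨ c i = 1 := by
        have := h₂ i hP
        lia
      · exact Or.inr (Or.inr (Or.inl ⟨hy₀.1 hP hc, ih _ _ _ _ hl.2 hx₀.2 hx₁.2
          (fun j hj hPj hcj => step j hj hPj (hcj.trans hc.symm)) hy₁.2⟩))
      · exact Or.inr (Or.inr (Or.inr ⟨hy₁.1 hP hc, ih _ _ _ _ hl.2 hx₀.2 hx₁.2 hy₀.2
          (fun j hj hPj hcj => step j hj hPj (hcj.trans hc.symm))⟩))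

/-- A `(2,2)`-critical permutation of length fifteen without increasing subsequences of
length four. -/
def seed : Equiv.Perm (Fin 15) where
  toFun := ![7, 13, 14, 2, 10, 0, 8, 12, 6, 4, 11, 9, 5, 1, 3]
  invFun := ![5, 13, 3, 14, 9, 12, 8, 0, 6, 11, 4, 10, 7, 1, 2]
  left_inv := by decide
  right_inv := by decide

/-- Row `i` covers `seed` minus the index `i`: entries `0`, `1` stand for increasing and
`2`, `3` for decreasing subsequences. -/
def seedDeletionCover : Fin 15 → Fin 15 → ℕ := ![
  ![0, 2, 3, 0, 0, 1, 1, 0, 2, 2, 1, 3, 3, 2, 3],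
  ![2, 0, 3, 0, 0, 1, 1, 0, 2, 2, 1, 3, 3, 2, 3],
  ![2, 3, 0, 0, 0, 1, 1, 0, 2, 2, 1, 3, 3, 2, 3],
  ![0, 0, 0, 0, 2, 1, 1, 1, 2, 2, 3, 3, 3, 2, 3],
  ![0, 2, 3, 2, 0, 1, 0, 3, 3, 1, 0, 1, 3, 2, 3],
  ![0, 0, 0, 1, 1, 0, 2, 1, 2, 2, 3, 3, 3, 2, 3],
  ![0, 2, 3, 2, 0, 1, 0, 3, 3, 1, 0, 1, 3, 2, 3],
  ![0, 2, 3, 2, 0, 1, 3, 0, 3, 1, 0, 1, 3, 2, 3],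
  ![0, 2, 3, 2, 3, 1, 0, 0, 0, 1, 1, 3, 3, 2, 3],
  ![0, 2, 3, 2, 0, 1, 1, 3, 3, 0, 0, 1, 3, 2, 3],
  ![0, 2, 3, 2, 0, 1, 3, 0, 3, 1, 0, 1, 3, 2, 3],
  ![0, 2, 3, 2, 0, 1, 3, 0, 3, 1, 1, 0, 3, 2, 3],
  ![0, 2, 3, 2, 0, 1, 1, 3, 3, 3, 0, 1, 0, 2, 3],
  ![0, 2, 3, 1, 2, 2, 0, 3, 3, 1, 0, 1, 3, 0, 3],
  ![0, 2, 3, 1, 2, 2, 0, 3, 3, 1, 0, 1, 3, 3, 0]]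

/-- The length of a longest increasing subsequence of `seed` ending at an index, minus one. -/
def seedHeight : Fin 15 → ℕ := ![0, 1, 2, 0, 1, 0, 1, 2, 1, 1, 2, 2, 2, 1, 2]

theorem not_coverableOn_seed : ¬ CoverableOn seed Set.univ 2 2 := by
  rintro ⟨P, c, h₁, h₂, h₃⟩
  have h := twoTwoSearch_eq_true (fun i => h₁ i trivial) (fun i => h₂ i trivial)
    (fun i j => h₃ i trivial j trivial) (List.finRange 15) 0 0 15 15
    (List.pairwise_lt_finRange 15) (by simp) (by simp) (fun i _ _ _ => (seed i).isLt)
    (fun i _ _ _ => (seed i).isLt)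
  have hmap : ((List.finRange 15).map fun i => (seed i : ℕ)) =
      [7, 13, 14, 2, 10, 0, 8, 12, 6, 4, 11, 9, 5, 1, 3] := by decide
  have hfalse :
      twoTwoSearch [7, 13, 14, 2, 10, 0, 8, 12, 6, 4, 11, 9, 5, 1, 3] 0 0 15 15 = false := by
    decide +kernel
  rw [hmap, hfalse] at h
  exact Bool.false_ne_true h

theorem deletionSharp_seed : DeletionSharp seed 2 2 where
  not_coverable := not_coverableOn_seed
  deletion i := by
    refine ⟨fun j => seedDeletionCover i j < 2, fun j => seedDeletionCover i j % 2,
      fun j _ _ => Nat.mod_lt _ two_pos, fun j _ _ => Nat.mod_lt _ two_pos, ?_⟩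
    simp only [Set.mem_compl_iff, Set.mem_singleton_iff]
    revert i
    decide +kernel
  coverable := by
    refine ⟨fun _ => False, seedHeight, by simp, ?_, ?_⟩
    · simp only [Set.mem_univ, true_implies, not_false_eq_true]
      decide
    · simp only [Set.mem_univ, true_implies, not_false_eq_true, false_implies, true_and]
      decide +kernel

theorem exists_deletionSharp_pow (n : ℕ) :
    ∃ (m : ℕ) (π : Equiv.Perm (Fin m)),
      m = 15 ^ n ∧ DeletionSharp π (3 ^ n - 1) (3 ^ n - 1) := by
  induction n with
  | zero =>
    refine ⟨1, 1, rfl, not_coverableOn_one 0, fun i => ?_, ?_⟩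
    · refine ⟨fun _ => True, fun _ => 0, fun j hj => ?_, by simp, by simp⟩
      exact absurd (Subsingleton.elim j i) hj
    · exact ⟨fun _ => False, fun _ => 0, by simp, by simp, by simp⟩
  | succ n ih =>
    obtain ⟨m, π, rfl, hπ⟩ := ih
    have hpos : 0 < 3 ^ n := by positivity
    refine ⟨15 * 15 ^ n, tensorProd seed π, by rw [pow_succ'],
      deletionSharp_seed.tensorProd hπ ?_ ?_⟩ <;>
    · rw [Nat.sub_add_cancel (Nat.one_le_pow _ _ three_pos), Nat.sub_add_cancel hpos, pow_succ',
        two_add_one_eq_three]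

/-- For every `n` there is a `(2·3ⁿ − 2)`-critical permutation of length at least `15ⁿ`. -/
theorem long_critical_pow (n : ℕ) :
    ∃ (m : ℕ) (π : Equiv.Perm (Fin m)),
      15 ^ n ≤ m ∧ KCritical π (2 * 3 ^ n - 2) := by
  obtain ⟨m, π, rfl, hπ⟩ := exists_deletionSharp_pow n
  have hk : 3 ^ n - 1 + (3 ^ n - 1) = 2 * 3 ^ n - 2 := by lia
  exact hk ▸ hπ.exists_kCritical
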